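/- Let ν be a finite Borel measure on ℝ with total mass m = ν(ℝ) ≤ 1, and set a = ∫_ℝ φ(t) dν(t), where φ(t) = e^{−t²/2}/√(2π). If a = 0, then ν = 0 and ∫_ℝ (1 + |t|) φ(t) dν(t) = 0. If a > 0, then ∫_ℝ (1 + |t|) φ(t) dν(t) ≤ a · (1 + √(2 log(m/(√(2π} a)))) ≤ a · (1 + √(log(1/(2π a²)))) ≤ 2 a √(log(e/a²)). -/

import Mathlib

open MeasureTheory

/-- The standard normal density `φ(t) = e^{-t²/2}/√(2π)`. -/
noncomputable def stdNormalPDF (t : ℝ) : ℝ :=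
  Real.exp (-t ^ 2 / 2) / Real.sqrt (2 * Real.pi)

lemma phi_pos (t : ℝ) : 0 < stdNormalPDF t := by
  unfold stdNormalPDF; positivity

lemma phi_cont : Continuous stdNormalPDF := by
  unfold stdNormalPDF; fun_prop

lemma sqrt_two_pi_ge_one : 1 ≤ Real.sqrt (2 * Real.pi) := by
  rw [Real.one_le_sqrt]; linarith [Real.pi_gt_three]

lemma phi_le (t : ℝ) : (1 + t ^ 2 / 2) * stdNormalPDF t ≤ 1 := by
  have h1 := Real.add_one_le_exp (t ^ 2 / 2)
  have h2 : Real.exp (t ^ 2 / 2) * Real.exp (-t ^ 2 / 2) = 1 := by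
    rw [← Real.exp_add, ← Real.exp_zero]; congr 1; ring
  have h3 := Real.exp_pos (-t ^ 2 / 2)
  unfold stdNormalPDF
  rw [← mul_div_assoc, div_le_one (by positivity)]
  refine le_trans ?_ sqrt_two_pi_ge_one
  nlinarith

lemma int_phi (ν : Measure ℝ) [IsFiniteMeasure ν] : Integrable stdNormalPDF ν := by
  refine Integrable.of_bound phi_cont.aestronglyMeasurable 1 (Filter.Eventually.of_forall ?_)
  intro t
  rw [Real.norm_of_nonneg (phi_pos t).le]
  nlinarith [phi_le t, phi_pos t, mul_nonneg (sq_nonneg t) (phi_pos t).le]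

lemma int_sq (ν : Measure ℝ) [IsFiniteMeasure ν] :
    Integrable (fun t => t ^ 2 * stdNormalPDF t) ν := by
  refine Integrable.of_bound ((continuous_pow 2).mul phi_cont).aestronglyMeasurable 2
    (Filter.Eventually.of_forall ?_)
  intro t
  have := mul_nonneg (sq_nonneg t) (phi_pos t).le
  rw [Real.norm_of_nonneg this]
  nlinarith [phi_le t, phi_pos t]

lemma int_abs (ν : Measure ℝ) [IsFiniteMeasure ν] :
    Integrable (fun t => |t| * stdNormalPDF t) ν := by
  refine Integrable.of_bound (continuous_abs.mul phi_cont).aestronglyMeasurable 1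
    (Filter.Eventually.of_forall ?_)
  intro t
  have := mul_nonneg (abs_nonneg t) (phi_pos t).le
  rw [Real.norm_of_nonneg this]
  have h : |t| ≤ 1 + t ^ 2 / 2 := by
    nlinarith [sq_abs t, sq_nonneg (|t| - 1)]
  exact (mul_le_mul_of_nonneg_right h (phi_pos t).le).trans (phi_le t)

/-- Tangent line bound. -/
lemma phi_tangent (c t : ℝ) (hc : 0 < c) :
    t ^ 2 * stdNormalPDF t ≤
      2 * ((-Real.log c - 1) * stdNormalPDF t + c / Real.sqrt (2 * Real.pi)) := by
  have hw := Real.exp_pos (-t ^ 2 / 2)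
  have hs : 0 < Real.sqrt (2 * Real.pi) := by positivity
  have h := Real.log_le_sub_one_of_pos (div_pos hc hw)
  rw [Real.log_div hc.ne' hw.ne', Real.log_exp] at h
  have h2 : c / Real.exp (-t ^ 2 / 2) * Real.exp (-t ^ 2 / 2) = c := by field_simp
  have h3 := mul_le_mul_of_nonneg_right h hw.le
  unfold stdNormalPDF
  rw [← mul_div_assoc, ← mul_div_assoc, ← add_div, ← mul_div_assoc]
  refine div_le_div_of_nonneg_right ?_ hs.le
  nlinarith

/-- Bound on `∫ (1+|t|) φ(t) dν(t)` in terms of `a = ∫ φ dν` for a finite Borel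
measure `ν` on `ℝ` of total mass at most `1`. -/
theorem stmt12 (ν : Measure ℝ) [IsFiniteMeasure ν]
    (hm : (ν Set.univ).toReal ≤ 1) :
    ((∫ t, stdNormalPDF t ∂ν) = 0 →
      ν = 0 ∧ (∫ t, (1 + |t|) * stdNormalPDF t ∂ν) = 0) ∧
    (0 < ∫ t, stdNormalPDF t ∂ν →
      ((∫ t, (1 + |t|) * stdNormalPDF t ∂ν) ≤
        (∫ t, stdNormalPDF t ∂ν) *
          (1 + Real.sqrt (2 * Real.log ((ν Set.univ).toReal /
            (Real.sqrt (2 * Real.pi) * ∫ t, stdNormalPDF t ∂ν))))) ∧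
      ((∫ t, stdNormalPDF t ∂ν) *
          (1 + Real.sqrt (2 * Real.log ((ν Set.univ).toReal /
            (Real.sqrt (2 * Real.pi) * ∫ t, stdNormalPDF t ∂ν)))) ≤
        (∫ t, stdNormalPDF t ∂ν) *
          (1 + Real.sqrt (Real.log (1 /
            (2 * Real.pi * (∫ t, stdNormalPDF t ∂ν) ^ 2))))) ∧
      ((∫ t, stdNormalPDF t ∂ν) *
          (1 + Real.sqrt (Real.log (1 /
            (2 * Real.pi * (∫ t, stdNormalPDF t ∂ν) ^ 2)))) ≤
        2 * (∫ t, stdNormalPDF t ∂ν) *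
          Real.sqrt (Real.log (Real.exp 1 / (∫ t, stdNormalPDF t ∂ν) ^ 2)))) := by
  constructor
  · intro h
    have hν : ν = 0 := by
      rw [integral_eq_zero_iff_of_nonneg (fun t => (phi_pos t).le) (int_phi ν)] at h
      have h2 : ∀ᵐ t ∂ν, False := by
        filter_upwards [h] with t ht
        exact (phi_pos t).ne' ht
      simpa using h2
    refine ⟨hν, ?_⟩
    simp [hν]
  · intro ha
    have hs : 0 < Real.sqrt (2 * Real.pi) := by positivity
    have hs2 : Real.sqrt (2 * Real.pi) ^ 2 = 2 * Real.pi := Real.sq_sqrt (by positivity)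
    have hsplit : (∫ t, (1 + |t|) * stdNormalPDF t ∂ν) =
        (∫ t, stdNormalPDF t ∂ν) + ∫ t, |t| * stdNormalPDF t ∂ν := by
      rw [← integral_add (int_phi ν) (int_abs ν)]
      congr 1; ext t; ring
    have ham : (∫ t, stdNormalPDF t ∂ν) ≤ (ν Set.univ).toReal / Real.sqrt (2 * Real.pi) := by
      have h : (∫ t, stdNormalPDF t ∂ν) ≤ ∫ t, 1 / Real.sqrt (2 * Real.pi) ∂ν := by
        refine integral_mono (int_phi ν) (integrable_const _) ?_
        intro t
        unfold stdNormalPDF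
        refine div_le_div_of_nonneg_right ?_ hs.le
        rw [Real.exp_le_one_iff]
        nlinarith [sq_nonneg t]
      rw [integral_const, smul_eq_mul, measureReal_def] at h
      linarith [mul_one_div (ν Set.univ).toReal (Real.sqrt (2 * Real.pi))]
    have hmpos : 0 < (ν Set.univ).toReal := by
      by_contra hcon
      have : (ν Set.univ).toReal / Real.sqrt (2 * Real.pi) ≤ 0 :=
        div_nonpos_of_nonpos_of_nonneg (not_lt.mp hcon) hs.le
      linarith
    have hJ : ∀ c : ℝ, 0 < c → (∫ t, t ^ 2 * stdNormalPDF t ∂ν) ≤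
        2 * ((-Real.log c - 1) * (∫ t, stdNormalPDF t ∂ν) +
          (ν Set.univ).toReal * (c / Real.sqrt (2 * Real.pi))) := by
      intro c hc
      have hi := (int_phi ν).const_mul (-Real.log c - 1)
      have hk : Integrable (fun _ : ℝ => c / Real.sqrt (2 * Real.pi)) ν := integrable_const _
      have h := integral_mono (int_sq ν) ((hi.add hk).const_mul 2)
        (fun t => phi_tangent c t hc)
      refine h.trans_eq ?_
      rw [integral_const_mul]
      simp only [Pi.add_apply]
      rw [integral_add hi hk, integral_const_mul, integral_const, smul_eq_mul, measureReal_def]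
    have hCS : ∀ x : ℝ, 0 ≤ (∫ t, t ^ 2 * stdNormalPDF t ∂ν) -
        2 * x * (∫ t, |t| * stdNormalPDF t ∂ν) + x ^ 2 * ∫ t, stdNormalPDF t ∂ν := by
      intro x
      have h : 0 ≤ ∫ t, (|t| - x) ^ 2 * stdNormalPDF t ∂ν :=
        integral_nonneg (fun t => mul_nonneg (sq_nonneg _) (phi_pos t).le)
      have e : (fun t => (|t| - x) ^ 2 * stdNormalPDF t) = fun t =>
          (t ^ 2 * stdNormalPDF t - 2 * x * (|t| * stdNormalPDF t)) + x ^ 2 * stdNormalPDF t := by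
        ext t
        rw [← sq_abs t]; ring
      have hd : Integrable (fun t => t ^ 2 * stdNormalPDF t - 2 * x * (|t| * stdNormalPDF t)) ν :=
        (int_sq ν).sub ((int_abs ν).const_mul _)
      rw [e, integral_add hd ((int_phi ν).const_mul _),
        integral_sub (int_sq ν) ((int_abs ν).const_mul _), integral_const_mul,
        integral_const_mul] at h
      exact h
    rw [hsplit]
    generalize (∫ t, stdNormalPDF t ∂ν) = a at *
    generalize (∫ t, |t| * stdNormalPDF t ∂ν) = C at *
    generalize (∫ t, t ^ 2 * stdNormalPDF t ∂ν) = B at *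
    generalize (ν Set.univ).toReal = m at *
    have hlog2 : Real.log (1 / (2 * Real.pi * a ^ 2)) =
        2 * Real.log (1 / (Real.sqrt (2 * Real.pi) * a)) := by
      rw [← hs2, ← mul_pow, ← one_div_pow, Real.log_pow]; norm_num
    refine ⟨?_, ?_, ?_⟩
    · have h1 := hJ (Real.sqrt (2 * Real.pi) * a / m) (by positivity)
      have h2 := hCS (C / a)
      have h3 : Real.log (Real.sqrt (2 * Real.pi) * a / m) =
          -Real.log (m / (Real.sqrt (2 * Real.pi) * a)) := by
        rw [← Real.log_inv, inv_div]
      rw [h3] at h1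
      generalize Real.log (m / (Real.sqrt (2 * Real.pi) * a)) = L at *
      have h4 : m * (Real.sqrt (2 * Real.pi) * a / m / Real.sqrt (2 * Real.pi)) = a := by
        field_simp
      rw [h4] at h1
      have h5 : B - 2 * (C / a) * C + (C / a) ^ 2 * a = B - (C / a) ^ 2 * a := by
        field_simp; ring
      rw [h5] at h2
      have h6 : (C / a) ^ 2 ≤ 2 * L := by
        refine le_of_mul_le_mul_right ?_ ha
        linarith
      have h7 := (le_abs_self _).trans (Real.abs_le_sqrt h6)
      rw [div_le_iff₀ ha] at h7
      linarith
    · refine mul_le_mul_of_nonneg_left ?_ ha.le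
      rw [hlog2]
      gcongr
    · have hu : 0 ≤ Real.log (1 / (2 * Real.pi * a ^ 2)) := by
        rw [hlog2]
        have : 0 ≤ Real.log (1 / (Real.sqrt (2 * Real.pi) * a)) := by
          apply Real.log_nonneg
          rw [one_le_div (by positivity)]
          rw [le_div_iff₀ hs] at ham
          linarith
        linarith
      have hv : Real.log (Real.exp 1 / a ^ 2) =
          1 + Real.log (1 / (2 * Real.pi * a ^ 2)) + Real.log (2 * Real.pi) := by
        rw [Real.log_div (by positivity) (by positivity), Real.log_exp, one_div, Real.log_inv,
          Real.log_mul (by positivity) (by positivity)]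
        ring
      have hp : 0 ≤ Real.log (2 * Real.pi) :=
        Real.log_nonneg (by linarith [Real.pi_gt_three])
      rw [hv]
      have e1 : 1 ≤ Real.sqrt (1 + Real.log (1 / (2 * Real.pi * a ^ 2)) +
          Real.log (2 * Real.pi)) := by
        rw [Real.one_le_sqrt]; linarith
      have e2 : Real.sqrt (Real.log (1 / (2 * Real.pi * a ^ 2))) ≤
          Real.sqrt (1 + Real.log (1 / (2 * Real.pi * a ^ 2)) + Real.log (2 * Real.pi)) :=
        Real.sqrt_le_sqrt (by linarith)
      rw [mul_comm 2 a, mul_assoc a 2]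
      refine mul_le_mul_of_nonneg_left ?_ ha.le
      linarith
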